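/- There is a constant c > 0 such that for every power of 2 N ≥ 2 with m = N·log₂N, every integer t ≥ 1, and every integer d with 0 ≤ d < c·N^{2/3}/log₂N, the function F = OR_t(ED_N,…,ED_N) : ({-1,1}^m)^t → {-1,1} satisfies W(F, d) > 2^t; that is, every polynomial threshold function for F of degree at most d has weight greater than 2^t. -/

import Mathlib

open Finset

noncomputable section

/-- The real value of a Boolean bit: `true` encodes `-1` (logical TRUE), `false` encodes `1`. -/
def bval (b : Bool) : ℝ := if b then -1 else 1

/-- The parity character `χ_S(x) = ∏_{i ∈ S} x_i`. -/
def chi {ι : Type*} (S : Finset ι) (x : ι → Bool) : ℝ := ∏ i ∈ S, bval (x i)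

/-- The multilinear polynomial with coefficient family `c`. -/
def polyOf {ι : Type*} [Fintype ι] (c : Finset ι → ℝ) (x : ι → Bool) : ℝ :=
  ∑ S : Finset ι, c S * chi S x

/-- Read an input `x ∈ {-1,1}^{N·k}` (indexed as `N` blocks of `k` bits) as a function
`g_x : [N] → [2^k]`, each block giving the binary representation of its value. -/
def gOf {N k : ℕ} (x : Fin N × Fin k → Bool) (i : Fin N) : Fin (2 ^ k) :=
  finFunctionFinEquiv (fun j => if x (i, j) then 1 else 0)

/-- The Element Distinctness function on `N = 2^k` blocks of `k` bits: it is TRUE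
(`true`, i.e. `-1`) iff the `N` encoded numbers are pairwise distinct. -/
def ED (k : ℕ) (x : Fin (2 ^ k) × Fin k → Bool) : Bool :=
  decide (Function.Injective (gOf x))

/-- The block composition `OR_t(f, …, f)`; it is TRUE (`true`, i.e. `-1`) iff some copy of
`f` is TRUE. -/
def orBlock (t : ℕ) {ι : Type*} [Fintype ι] [DecidableEq ι]
    (f : (ι → Bool) → Bool) (x : Fin t × ι → Bool) : Bool :=
  decide (∃ i : Fin t, f (fun j => x (i, j)) = true)

theorem prodIcc_fact (n : ℕ) : ∏ j ∈ Icc 1 n, j = n.factorial := by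
  induction n with
  | zero => simp
  | succ n ih => rw [Finset.prod_Icc_succ_top (by omega), ih, Nat.factorial_succ, mul_comm]

theorem prod_split (d i : ℕ) (hi : i ∈ Icc 1 d) (g : ℕ → ℝ) :
    ∏ j ∈ (Icc 1 d).erase i, g ((i:ℤ) - j).natAbs =
      (∏ k ∈ Icc 1 (i-1), g k) * ∏ k ∈ Icc 1 (d-i), g k := by
  rw [mem_Icc] at hi
  have h1 : (Icc 1 d).erase i = Icc 1 (i-1) ∪ Icc (i+1) d := by
    ext j; simp only [mem_erase, mem_Icc, mem_union]; omega
  have h2 : Disjoint (Icc 1 (i-1)) (Icc (i+1) d) := by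
    rw [Finset.disjoint_left]; intro j; simp only [mem_Icc]; omega
  rw [h1, prod_union h2]
  congr 1
  · refine prod_nbij' (fun j => i - j) (fun j => i - j) ?_ ?_ ?_ ?_ ?_ <;> intro j <;> simp only [mem_Icc] <;> intro hj
    · omega
    · omega
    · omega
    · omega
    · congr 1; omega
  · refine prod_nbij' (fun j => j - i) (fun j => j + i) ?_ ?_ ?_ ?_ ?_ <;> intro j <;> simp only [mem_Icc] <;> intro hj
    · omega
    · omega
    · omega
    · omega
    · congr 1; omega
theorem sum_split (d i : ℕ) (hi : i ∈ Icc 1 d) (g : ℕ → ℝ) :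
    ∑ j ∈ (Icc 1 d).erase i, g ((i:ℤ) - j).natAbs =
      (∑ k ∈ Icc 1 (i-1), g k) + ∑ k ∈ Icc 1 (d-i), g k := by
  rw [mem_Icc] at hi
  have h1 : (Icc 1 d).erase i = Icc 1 (i-1) ∪ Icc (i+1) d := by
    ext j; simp only [mem_erase, mem_Icc, mem_union]; omega
  have h2 : Disjoint (Icc 1 (i-1)) (Icc (i+1) d) := by
    rw [Finset.disjoint_left]; intro j; simp only [mem_Icc]; omega
  rw [h1, sum_union h2]
  congr 1
  · refine sum_nbij' (fun j => i - j) (fun j => i - j) ?_ ?_ ?_ ?_ ?_ <;> intro j <;> simp only [mem_Icc] <;> intro hj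
    · omega
    · omega
    · omega
    · omega
    · congr 1; omega
  · refine sum_nbij' (fun j => j - i) (fun j => j + i) ?_ ?_ ?_ ?_ ?_ <;> intro j <;> simp only [mem_Icc] <;> intro hj
    · omega
    · omega
    · omega
    · omega
    · congr 1; omega

theorem natAbs_cast_real (i j : ℕ) : ((((i:ℤ) - j).natAbs : ℕ) : ℝ) = |(i:ℝ) - j| := by
  rw [Nat.cast_natAbs]; push_cast; rfl

theorem prod_sq_ratio (d i : ℕ) (hi : i ∈ Icc 1 d) :
    ∏ j ∈ (Icc 1 d).erase i, ((j:ℝ)^2 / |(j:ℝ)^2 - (i:ℝ)^2|) ≤ 2 := by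
  have hi' := mem_Icc.1 hi
  have hipos : (0:ℝ) < i := by exact_mod_cast hi'.1
  have e1 : ∏ j ∈ (Icc 1 d).erase i, ((j:ℝ)^2 / |(j:ℝ)^2 - (i:ℝ)^2|) =
      (∏ j ∈ (Icc 1 d).erase i, (j:ℝ))^2 /
        ((∏ j ∈ (Icc 1 d).erase i, ((((i:ℤ) - j).natAbs : ℕ) : ℝ)) *
          ∏ j ∈ (Icc 1 d).erase i, ((j:ℝ) + i)) := by
    rw [← prod_mul_distrib, ← prod_pow, ← prod_div_distrib]
    refine prod_congr rfl fun j hj => ?_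
    rw [natAbs_cast_real, abs_sub_comm (i:ℝ) j, ← abs_of_nonneg (by positivity : (0:ℝ) ≤ (j:ℝ) + i), ← abs_mul]
    congr 2; ring
  have hA : (i:ℝ) * ∏ j ∈ (Icc 1 d).erase i, (j:ℝ) = (d.factorial : ℝ) := by
    rw [mul_prod_erase (Icc 1 d) (fun j : ℕ => (j:ℝ)) hi]
    rw [← prodIcc_fact]; push_cast; rfl
  have hB : ∏ j ∈ (Icc 1 d).erase i, ((((i:ℤ) - j).natAbs : ℕ) : ℝ) =
      ((i-1).factorial : ℝ) * ((d-i).factorial : ℝ) := by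
    rw [prod_split d i hi (fun k => (k:ℝ)), ← prodIcc_fact,
      ← prodIcc_fact]
    push_cast; rfl
  have hC0 : ∀ n : ℕ, (∏ j ∈ Icc 1 n, ((j:ℝ) + i)) * (i.factorial : ℝ) = ((n+i).factorial : ℝ) := by
    intro n
    induction n with
    | zero => simp
    | succ n ih =>
      rw [Finset.prod_Icc_succ_top (by omega), mul_right_comm, ih,
        show n + 1 + i = (n+i)+1 by ring, Nat.factorial_succ]
      push_cast; ring
  have hC : (2 * i : ℝ) * (∏ j ∈ (Icc 1 d).erase i, ((j:ℝ) + i)) * (i.factorial : ℝ) = ((d+i).factorial : ℝ) := by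
    rw [← hC0 d, ← mul_prod_erase (Icc 1 d) (fun j : ℕ => (j:ℝ) + i) hi]; ring
  have hif : (i.factorial : ℝ) = i * ((i-1).factorial : ℝ) := by
    obtain ⟨m, rfl⟩ : ∃ m, i = m + 1 := ⟨i-1, by omega⟩
    rw [Nat.factorial_succ]; push_cast; simp
  have hfac : (d.factorial : ℝ)^2 ≤ ((d-i).factorial : ℝ) * ((d+i).factorial : ℝ) := by
    have h1 : d.factorial * (d+1)^i ≤ (d+i).factorial := Nat.factorial_mul_pow_le_factorial
    have h2 := Nat.descFactorial_le_pow d i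
    have h3 := Nat.factorial_mul_descFactorial hi'.2
    have h4 : d ^ i ≤ (d+1)^i := Nat.pow_le_pow_left (by omega) i
    have : d.factorial^2 ≤ (d-i).factorial * (d+i).factorial := by
      calc d.factorial^2 = (d-i).factorial * (d.factorial * d.descFactorial i) := by
            rw [sq]; nth_rewrite 1 [← h3]; ring
        _ ≤ (d-i).factorial * (d.factorial * (d+1)^i) := by gcongr; omega
        _ ≤ _ := by gcongr
    exact_mod_cast this
  rw [e1, hB]
  set a := ∏ j ∈ (Icc 1 d).erase i, (j:ℝ)
  set b := ∏ j ∈ (Icc 1 d).erase i, ((j:ℝ) + i)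
  have hf1 : (0:ℝ) < (i-1).factorial := by exact_mod_cast Nat.factorial_pos _
  have hf2 : (0:ℝ) < (d-i).factorial := by exact_mod_cast Nat.factorial_pos _
  have hb : 0 < b := prod_pos fun j hj => by positivity
  rw [div_le_iff₀ (by positivity)]
  rw [← hA, ← hC, hif] at hfac
  have : (i:ℝ)^2 * a^2 ≤ (i:ℝ)^2 * (2 * ((((i-1).factorial : ℝ) * ((d-i).factorial : ℝ)) * b)) := by nlinarith
  exact le_of_mul_le_mul_left this (by positivity)

theorem sum_inv_dist (d i : ℕ) (hi : i ∈ Icc 1 d) :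
    ∑ j ∈ (Icc 1 d).erase i, 1 / |(i:ℝ) - j| ≤ 2 * (harmonic d : ℝ) := by
  have hi' := mem_Icc.1 hi
  have h := sum_split d i hi (fun k => 1 / (k:ℝ))
  simp only [natAbs_cast_real] at h
  rw [h]
  have hh : (harmonic d : ℝ) = ∑ k ∈ Icc 1 d, 1 / (k:ℝ) := by
    rw [harmonic_eq_sum_Icc]; push_cast; simp
  have hle : ∀ n ≤ d, ∑ k ∈ Icc 1 n, 1 / (k:ℝ) ≤ (harmonic d : ℝ) := by
    intro n hn
    rw [hh]
    exact sum_le_sum_of_subset_of_nonneg (Icc_subset_Icc_right hn) (fun _ _ _ => by positivity)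
  have := hle (i-1) (by omega)
  have := hle (d-i) (by omega)
  linarith
theorem sum_inv_sq (d : ℕ) : ∑ j ∈ Icc 1 d, 1 / (j:ℝ)^2 ≤ 2 - 1 / (d:ℝ) := by
  induction d with
  | zero => simp
  | succ n ih =>
    rw [Finset.sum_Icc_succ_top (by omega)]
    rcases Nat.eq_zero_or_pos n with rfl | hn
    · norm_num
    have hn' : (0:ℝ) < n := by exact_mod_cast hn
    have : (1:ℝ) / ((n+1:ℕ):ℝ)^2 ≤ 1/(n:ℝ) - 1/((n+1:ℕ):ℝ) := by
      push_cast
      rw [div_sub_div _ _ (by positivity) (by positivity), div_le_div_iff₀ (by positivity) (by positivity)]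
      nlinarith
    linarith

theorem prod_one_sub_ge (s : Finset ℕ) (u : ℕ → ℝ) (h0 : ∀ j ∈ s, 0 ≤ u j) (h1 : ∀ j ∈ s, u j ≤ 1) :
    1 - ∑ j ∈ s, u j ≤ ∏ j ∈ s, (1 - u j) := by
  induction s using Finset.induction_on with
  | empty => simp
  | insert a s ha ih =>
    rw [sum_insert ha, prod_insert ha]
    have ih := ih (fun j hj => h0 j (mem_insert_of_mem hj)) (fun j hj => h1 j (mem_insert_of_mem hj))
    have a0 := h0 a (mem_insert_self _ _)
    have a1 := h1 a (mem_insert_self _ _)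
    have hp : ∏ j ∈ s, (1 - u j) ≤ 1 := prod_le_one
      (fun j hj => by linarith [h1 j (mem_insert_of_mem hj)])
      (fun j hj => by linarith [h0 j (mem_insert_of_mem hj)])
    nlinarith

open Polynomial in
theorem node_bound {d : ℕ} (P : ℝ[X]) (hdeg : P.natDegree ≤ d) (h0 : P.eval 0 = 0) (B : ℝ)
    (hB : ∀ M : ℕ, 1 ≤ M → |P.eval (1 / (M:ℝ))| ≤ B) (Q : ℝ) (hQ1 : 1 ≤ Q)
    (hQ : 4 * (harmonic d : ℝ) ≤ Q) (M0 : ℕ) (hM0 : Q * (d:ℝ)^3 ≤ M0) (hM0' : 1 ≤ M0) :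
    |P.eval (1 / (M0:ℝ))| ≤ 8 * Q * (d:ℝ)^3 / M0 * B := by
  have hB0 : 0 ≤ B := (abs_nonneg _).trans (hB 1 le_rfl)
  have hM0p : (0:ℝ) < M0 := by exact_mod_cast hM0'
  set K : ℝ := Q * (d:ℝ)^3 with hK
  set M : ℕ → ℕ := fun j => ⌊K / (j:ℝ)^2⌋₊ with hM
  set v : ℕ → ℝ := fun j => 1 / (M j : ℝ) with hv
  set y : ℝ := 1 / (M0:ℝ) with hy
  have hypos : 0 < y := by positivity
  have hv0 : v 0 = 0 := by simp [hv, hM]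
  have hMle : ∀ j : ℕ, (M j : ℝ) ≤ K / (j:ℝ)^2 := fun j => Nat.floor_le (by positivity)
  have hMlt : ∀ j : ℕ, K / (j:ℝ)^2 < (M j : ℝ) + 1 := fun j => Nat.lt_floor_add_one _
  have hMge : ∀ j ∈ Icc 1 d, 1 ≤ M j := by
    intro j hj
    rw [mem_Icc] at hj
    apply Nat.le_floor
    have hj0 : (1:ℝ) ≤ j := by exact_mod_cast hj.1
    have hjd : (j:ℝ) ≤ d := by exact_mod_cast hj.2
    rw [Nat.cast_one, le_div_iff₀ (by positivity), one_mul, hK]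
    have : (j:ℝ)^2 ≤ (d:ℝ)^2 := by gcongr
    have : (d:ℝ)^2 ≤ (d:ℝ)^3 := by gcongr <;> [linarith; norm_num]
    nlinarith [pow_nonneg (Nat.cast_nonneg d : (0:ℝ) ≤ d) 3]
  -- the separations
  set u : ℕ → ℕ → ℝ := fun i j => 1 / (Q * |(i:ℝ) - j|) with hu
  have hD : ∀ i ∈ Icc 1 d, ∀ j ∈ (Icc 1 d).erase i,
      |K / (i:ℝ)^2 - K / (j:ℝ)^2| * (1 - u i j) ≤ |(M i : ℝ) - M j| := by
    intro i hi j hj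
    rw [mem_erase] at hj
    obtain ⟨hij, hj⟩ := hj
    rw [mem_Icc] at hi hj
    have hi0 : (1:ℝ) ≤ i := by exact_mod_cast hi.1
    have hid : (i:ℝ) ≤ d := by exact_mod_cast hi.2
    have hj0 : (1:ℝ) ≤ j := by exact_mod_cast hj.1
    have hjd : (j:ℝ) ≤ d := by exact_mod_cast hj.2
    have hne : 0 < |(i:ℝ) - j| := by
      rw [abs_pos, sub_ne_zero]; exact_mod_cast hij.symm
    have h1 : |K / (i:ℝ)^2 - K / (j:ℝ)^2| - 1 ≤ |(M i : ℝ) - M j| := by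
      have a1 := hMle i
      have a2 := hMlt i
      have a3 := hMle j
      have a4 := hMlt j
      rcases abs_cases (K / (i:ℝ)^2 - K / (j:ℝ)^2) with h | h <;>
        rcases abs_cases ((M i : ℝ) - M j) with h' | h' <;> linarith
    have h2 : 1 ≤ |K / (i:ℝ)^2 - K / (j:ℝ)^2| * u i j := by
      have e : K / (i:ℝ)^2 - K / (j:ℝ)^2 = K * ((j + i) / ((i:ℝ)^2 * (j:ℝ)^2)) * (j - i) := by
        field_simp; ring
      rw [e, abs_mul, abs_of_nonneg (by positivity), abs_sub_comm (j:ℝ), hu]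
      simp only
      rw [hK]
      have : Q * (d:ℝ)^3 * ((j + i) / ((i:ℝ)^2 * (j:ℝ)^2)) * |(i:ℝ) - j| * (1 / (Q * |(i:ℝ) - j|))
        = ((d:ℝ)^3 * (j + i)) / ((i:ℝ)^2 * (j:ℝ)^2) := by
        field_simp
      rw [this, one_le_div (by positivity)]
      calc (i:ℝ)^2 * (j:ℝ)^2 = (i * j * j) * i := by ring
        _ ≤ (d * d * d) * i := by gcongr
        _ ≤ (d:ℝ)^3 * (j + i) := by
          have : (0:ℝ) ≤ (d:ℝ)^3 * j := by positivity
          nlinarith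
    linarith
  have husum : ∀ i ∈ Icc 1 d, ∑ j ∈ (Icc 1 d).erase i, u i j ≤ 1 / 2 := by
    intro i hi
    have := sum_inv_dist d i hi
    have e : ∑ j ∈ (Icc 1 d).erase i, u i j = (1 / Q) * ∑ j ∈ (Icc 1 d).erase i, 1 / |(i:ℝ) - j| := by
      rw [mul_sum]; refine sum_congr rfl fun j _ => ?_
      simp only [hu]; rw [one_div_mul_one_div]
    rw [e, one_div_mul_eq_div, div_le_iff₀ (by linarith)]
    linarith
  have hu0 : ∀ i j, 0 ≤ u i j := fun i j => by simp only [hu]; positivity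
  have hu1 : ∀ i ∈ Icc 1 d, ∀ j ∈ (Icc 1 d).erase i, u i j ≤ 1 / 2 := fun i hi j hj =>
    (single_le_sum (f := fun j => u i j) (fun k _ => hu0 i k) hj).trans (husum i hi)
  have hXne : ∀ i ∈ Icc 1 d, ∀ j ∈ (Icc 1 d).erase i, 0 < |(j:ℝ)^2 - (i:ℝ)^2| := by
    intro i hi j hj
    rw [mem_erase] at hj
    rw [abs_pos, sub_ne_zero]
    intro h
    apply hj.1
    have : j^2 = i^2 := by exact_mod_cast h
    exact Nat.pow_left_injective (n := 2) (by norm_num) this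
  have hDeq : ∀ i ∈ Icc 1 d, ∀ j ∈ (Icc 1 d).erase i,
      |K / (i:ℝ)^2 - K / (j:ℝ)^2| = K / (i:ℝ)^2 * (|(j:ℝ)^2 - (i:ℝ)^2| / (j:ℝ)^2) := by
    intro i hi j hj
    have hi0 : (0:ℝ) < i := by exact_mod_cast (mem_Icc.1 hi).1
    have hj0 : (0:ℝ) < j := by exact_mod_cast (mem_Icc.1 (mem_erase.1 hj).2).1
    have e : K / (i:ℝ)^2 - K / (j:ℝ)^2 = K / ((i:ℝ)^2 * (j:ℝ)^2) * ((j:ℝ)^2 - (i:ℝ)^2) := by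
      field_simp
    rw [e, abs_mul, abs_of_nonneg (by positivity)]
    field_simp
  have hKpos : ∀ i ∈ Icc 1 d, 0 < K := by
    intro i hi
    rw [mem_Icc] at hi
    have : (0:ℝ) < d := by exact_mod_cast (by omega : 0 < d)
    positivity
  have hMne : ∀ i ∈ Icc 1 d, ∀ j ∈ (Icc 1 d).erase i, 0 < |(M i : ℝ) - M j| := by
    intro i hi j hj
    refine lt_of_lt_of_le ?_ (hD i hi j hj)
    have hi0 : (0:ℝ) < i := by exact_mod_cast (mem_Icc.1 hi).1
    have hj0 : (0:ℝ) < j := by exact_mod_cast (mem_Icc.1 (mem_erase.1 hj).2).1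
    have := hKpos i hi
    have := hXne i hi j hj
    have := hu1 i hi j hj
    rw [hDeq i hi j hj]
    apply mul_pos (by positivity) (by linarith)
  have hinj : Set.InjOn v (range (d+1) : Finset ℕ) := by
    intro i hi j hj hij
    simp only [coe_range, Set.mem_Iio] at hi hj
    by_contra hne
    have hz : ∀ j ∈ Icc 1 d, v j ≠ 0 := by
      intro j hj
      have := hMge j hj
      have : (0:ℝ) < M j := by exact_mod_cast this
      simp only [hv]; positivity
    rcases Nat.eq_zero_or_pos i with rfl | hi0
    · exact hz j (mem_Icc.2 (by omega)) (hij ▸ hv0)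
    rcases Nat.eq_zero_or_pos j with rfl | hj0
    · exact hz i (mem_Icc.2 (by omega)) (hij.trans hv0)
    have h := hMne i (mem_Icc.2 (by omega)) j (mem_erase.2 ⟨fun h => hne h.symm, mem_Icc.2 (by omega)⟩)
    simp only [hv] at hij
    have : (M i : ℝ) = M j := by simpa using hij
    rw [this] at h; simp at h
  have hins : range (d+1) = insert 0 (Icc 1 d) := by
    ext j; simp only [mem_range, mem_insert, mem_Icc]; omega
  have hterm : ∀ i ∈ Icc 1 d, |(Lagrange.basis (range (d+1)) v i).eval y| ≤ 4 * y * (K / (i:ℝ)^2) := by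
    intro i hi
    have hi1 := mem_Icc.1 hi
    have hi0 : (0:ℝ) < i := by exact_mod_cast hi1.1
    have her : (range (d+1)).erase i = insert 0 ((Icc 1 d).erase i) := by
      rw [hins, erase_insert_of_ne (by omega)]
    have hMi : (0:ℝ) < M i := by exact_mod_cast hMge i hi
    unfold Lagrange.basis
    rw [her, prod_insert (by simp), eval_mul, eval_prod, abs_mul, abs_prod]
    have e0 : |eval y (Lagrange.basisDivisor (v i) (v 0))| ≤ y * (K / (i:ℝ)^2) := by
      rw [hv0]
      simp only [Lagrange.basisDivisor, eval_mul, eval_C, eval_sub, eval_X, sub_zero]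
      simp only [hv]
      rw [one_div, inv_inv, abs_of_nonneg (by positivity), mul_comm]
      exact mul_le_mul_of_nonneg_left (hMle i) hypos.le
    have ej : ∀ j ∈ (Icc 1 d).erase i, |eval y (Lagrange.basisDivisor (v i) (v j))| ≤
        ((j:ℝ)^2 / |(j:ℝ)^2 - (i:ℝ)^2|) / (1 - u i j) := by
      intro j hj
      have hj' := (mem_erase.1 hj).2
      have hj0 : (0:ℝ) < j := by exact_mod_cast (mem_Icc.1 hj').1
      have hMj : (0:ℝ) < M j := by exact_mod_cast hMge j hj'
      have hMM := hMne i hi j hj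
      have hXX := hXne i hi j hj
      have huu := hu1 i hi j hj
      have hKK := hKpos i hi
      simp only [Lagrange.basisDivisor, eval_mul, eval_C, eval_sub, eval_X]
      rw [abs_mul, abs_inv]
      have b1 : |y - v j| ≤ v j := by
        have : y ≤ v j := by
          simp only [hy, hv]
          apply one_div_le_one_div_of_le hMj
          refine (hMle j).trans (le_trans ?_ hM0)
          apply div_le_self hKK.le
          have : (1:ℝ) ≤ j := by exact_mod_cast (mem_Icc.1 hj').1
          nlinarith
        rw [abs_sub_comm, abs_of_nonneg (by linarith)]; linarith
      have b2 : |v i - v j| = |(M i : ℝ) - M j| / (M i * M j) := by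
        simp only [hv]
        rw [div_sub_div _ _ hMi.ne' hMj.ne', abs_div, abs_of_nonneg (by positivity : (0:ℝ) ≤ M i * M j), abs_sub_comm (M i : ℝ)]
        ring_nf
      calc |v i - v j|⁻¹ * |y - v j| ≤ |v i - v j|⁻¹ * v j := by gcongr
        _ = M i / |(M i : ℝ) - M j| := by rw [b2]; simp only [hv]; field_simp
        _ ≤ (K / (i:ℝ)^2) / (K / (i:ℝ)^2 * (|(j:ℝ)^2 - (i:ℝ)^2| / (j:ℝ)^2) * (1 - u i j)) := by
          have h3 := hD i hi j hj
          rw [hDeq i hi j hj] at h3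
          apply div_le_div₀ (by positivity) (hMle i) _ h3
          apply mul_pos (by positivity) (by linarith)
        _ = _ := by
          have : 1 - u i j ≠ 0 := by linarith
          field_simp
    have eprod : ∏ j ∈ (Icc 1 d).erase i, |eval y (Lagrange.basisDivisor (v i) (v j))| ≤ 4 := by
      calc _ ≤ ∏ j ∈ (Icc 1 d).erase i, ((j:ℝ)^2 / |(j:ℝ)^2 - (i:ℝ)^2|) / (1 - u i j) :=
            prod_le_prod (fun _ _ => abs_nonneg _) ej
        _ = (∏ j ∈ (Icc 1 d).erase i, ((j:ℝ)^2 / |(j:ℝ)^2 - (i:ℝ)^2|)) /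
            ∏ j ∈ (Icc 1 d).erase i, (1 - u i j) := prod_div_distrib ..
        _ ≤ 2 / (1 / 2) := by
          apply div_le_div₀ (by norm_num) (prod_sq_ratio d i hi) (by norm_num)
          have := prod_one_sub_ge ((Icc 1 d).erase i) (fun j => u i j) (fun j _ => hu0 i j)
            (fun j hj => (hu1 i hi j hj).trans (by norm_num))
          linarith [husum i hi]
        _ = 4 := by norm_num
    calc _ ≤ (y * (K / (i:ℝ)^2)) * 4 := by
          apply mul_le_mul e0 eprod (prod_nonneg fun _ _ => abs_nonneg _)
          positivity
      _ = _ := by ring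
  have hrep : P.eval y = ∑ i ∈ Icc 1 d, P.eval (v i) * (Lagrange.basis (range (d+1)) v i).eval y := by
    have hd : P.degree < #(range (d+1)) := by
      rw [card_range]
      exact lt_of_le_of_lt degree_le_natDegree (by exact_mod_cast Nat.lt_succ_of_le hdeg)
    have := congrArg (eval y) (Lagrange.eq_interpolate hinj hd)
    rw [Lagrange.interpolate_apply, eval_finsetSum] at this
    rw [this]
    simp only [eval_mul, eval_C]
    rw [sum_congr hins (fun _ _ => rfl), sum_insert (by simp), hv0, h0, zero_mul, zero_add]
  rw [hrep]
  calc |∑ i ∈ Icc 1 d, P.eval (v i) * (Lagrange.basis (range (d+1)) v i).eval y|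
      ≤ ∑ i ∈ Icc 1 d, |P.eval (v i) * (Lagrange.basis (range (d+1)) v i).eval y| :=
        abs_sum_le_sum_abs _ _
    _ ≤ ∑ i ∈ Icc 1 d, B * (4 * y * (K / (i:ℝ)^2)) := by
        refine sum_le_sum fun i hi => ?_
        rw [abs_mul]
        exact mul_le_mul (hB _ (hMge i hi)) (hterm i hi) (abs_nonneg _) hB0
    _ = B * 4 * y * K * ∑ i ∈ Icc 1 d, 1 / (i:ℝ)^2 := by
        rw [mul_sum]; refine sum_congr rfl fun i _ => by ring
    _ ≤ B * 4 * y * K * 2 := by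
        apply mul_le_mul_of_nonneg_left _ (by positivity)
        have : (0:ℝ) ≤ 1 / (d:ℝ) := by positivity
        linarith [sum_inv_sq d]
    _ = _ := by rw [hy, hK]; ring

open Polynomial in
/-- The weight polynomial of `h` restricted to `A`. -/
def wt {N : ℕ} (A : Finset (Fin N)) (h : Fin N → Fin N) : ℝ[X] :=
  C (1 / (N.descFactorial (A.image h).card : ℝ)) * X ^ (A.card - (A.image h).card) *
    ∏ i ∈ range (A.image h).card, (1 - C (i:ℝ) * X)

open Polynomial in
theorem wt_natDegree {N : ℕ} (A : Finset (Fin N)) (h : Fin N → Fin N) : (wt A h).natDegree ≤ A.card := by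
  unfold wt
  have hk : (A.image h).card ≤ A.card := card_image_le
  set k := (A.image h).card
  refine natDegree_mul_le.trans ?_
  have h1 : (C (1 / (N.descFactorial k : ℝ)) * X ^ (A.card - k) : ℝ[X]).natDegree ≤ A.card - k :=
    natDegree_C_mul_X_pow_le _ _
  have h2 : (∏ i ∈ range k, (1 - C (i:ℝ) * X) : ℝ[X]).natDegree ≤ k := by
    refine (natDegree_prod_le _ _).trans ?_
    calc _ ≤ ∑ i ∈ range k, 1 := by
          refine sum_le_sum fun i _ => ?_
          refine (natDegree_sub_le _ _).trans ?_
          simp only [natDegree_one, zero_le, sup_of_le_right]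
          exact (natDegree_C_mul_le _ _).trans natDegree_X_le
      _ = k := by simp
  omega

open Polynomial in
theorem wt_step {N : ℕ} (A : Finset (Fin N)) (a : Fin N) (ha : a ∉ A) (h : Fin N → Fin N) :
    ∑ v : Fin N, wt (insert a A) (Function.update h a v) = wt A h := by
  have him : ∀ v, (insert a A).image (Function.update h a v) = insert v (A.image h) := by
    intro v
    rw [image_insert, Function.update_self]
    congr 1
    refine image_congr fun j hj => ?_
    rw [Function.update_of_ne]; rintro rfl; exact ha hj
  have hk : (A.image h).card ≤ A.card := card_image_le
  have hA : A.card < N := by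
    have : (insert a A).card ≤ N := by simpa using card_le_univ (insert a A)
    rw [card_insert_of_notMem ha] at this; omega
  unfold wt
  simp only [him, card_insert_of_notMem ha]
  set I := A.image h
  set k := I.card with hkdef
  rw [← sum_add_sum_compl I]
  have e1 : ∑ v ∈ I, (C (1 / (N.descFactorial (insert v I).card : ℝ)) * X ^ (A.card + 1 - (insert v I).card) *
      ∏ i ∈ range (insert v I).card, (1 - C (i:ℝ) * X)) =
      k • (C (1 / (N.descFactorial k : ℝ)) * X ^ (A.card - k) * X *
      ∏ i ∈ range k, (1 - C (i:ℝ) * X)) := by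
    rw [sum_congr rfl (g := fun _ => C (1 / (N.descFactorial k : ℝ)) * X ^ (A.card - k) * X *
      ∏ i ∈ range k, (1 - C (i:ℝ) * X)), sum_const]
    intro v hv
    rw [insert_eq_of_mem hv, ← hkdef, show A.card + 1 - k = A.card - k + 1 by omega, pow_succ, mul_assoc (C _) _ X]
  have e2 : ∑ v ∈ Iᶜ, (C (1 / (N.descFactorial (insert v I).card : ℝ)) * X ^ (A.card + 1 - (insert v I).card) *
      ∏ i ∈ range (insert v I).card, (1 - C (i:ℝ) * X)) =
      (N - k) • (C (1 / (N.descFactorial (k+1) : ℝ)) * X ^ (A.card - k) *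
      ((∏ i ∈ range k, (1 - C (i:ℝ) * X)) * (1 - C (k:ℝ) * X))) := by
    rw [sum_congr rfl (g := fun _ => C (1 / (N.descFactorial (k+1) : ℝ)) * X ^ (A.card - k) *
      ((∏ i ∈ range k, (1 - C (i:ℝ) * X)) * (1 - C (k:ℝ) * X))), sum_const, card_compl, Fintype.card_fin]
    intro v hv
    rw [mem_compl] at hv
    rw [card_insert_of_notMem hv, ← hkdef, show A.card + 1 - (k+1) = A.card - k by omega, prod_range_succ]
  rw [e1, e2]
  have e3 : ((N - k : ℕ) : ℝ) * (1 / (N.descFactorial (k+1) : ℝ)) = 1 / (N.descFactorial k : ℝ) := by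
    rw [Nat.descFactorial_succ]
    have h1 : ((N - k : ℕ) : ℝ) ≠ 0 := by
      have : N - k ≠ 0 := by omega
      exact_mod_cast this
    have h2 : (N.descFactorial k : ℝ) ≠ 0 := by
      have : N.descFactorial k ≠ 0 := by rw [Ne, Nat.descFactorial_eq_zero_iff_lt]; omega
      exact_mod_cast this
    push_cast; field_simp
  have e4 : ((N - k : ℕ) : ℝ[X]) * C (1 / (N.descFactorial (k+1) : ℝ)) = C (1 / (N.descFactorial k : ℝ)) := by
    rw [← e3, C_mul]; simp
  have e5 : (C (k:ℝ) : ℝ[X]) = (k : ℝ[X]) := by simp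
  simp only [nsmul_eq_mul]
  rw [e5]
  linear_combination (X ^ (A.card - k) *
      ((∏ i ∈ range k, (1 - C (i:ℝ) * X)) * (1 - (k:ℝ[X]) * X))) * e4

theorem sum_update {N : ℕ} {R : Type*} [CommRing R] (a : Fin N) (F : (Fin N → Fin N) → R) :
    (N : R) * ∑ h, F h = ∑ h, ∑ v : Fin N, F (Function.update h a v) := by
  have key : ∑ h : Fin N → Fin N, ∑ v : Fin N, F (Function.update h a v) = ∑ h : Fin N → Fin N, ∑ _v : Fin N, F h := by
    rw [← sum_product', ← sum_product']
    refine sum_nbij' (fun p => (Function.update p.1 a p.2, p.1 a)) (fun p => (Function.update p.1 a p.2, p.1 a)) ?_ ?_ ?_ ?_ ?_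
    all_goals intro p _
    all_goals simp
  rw [key]
  simp [mul_sum]

open Polynomial in
theorem wt_marginal {N : ℕ} (φ : (Fin N → Fin N) → ℝ) (S : Finset (Fin N))
    (hφ : ∀ h h' : Fin N → Fin N, (∀ i ∈ S, h i = h' i) → φ h = φ h') (D : Finset (Fin N)) (hD : Disjoint S D) :
    (N:ℝ[X]) ^ D.card * ∑ h, C (φ h) * wt (S ∪ D) h = ∑ h, C (φ h) * wt S h := by
  induction D using Finset.induction_on with
  | empty => simp
  | insert a D ha ih =>
    rw [disjoint_insert_right] at hD
    have haS : a ∉ S ∪ D := by simp [hD.1, ha]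
    rw [← ih hD.2, card_insert_of_notMem ha, pow_succ, mul_assoc, sum_update a, union_insert]
    congr 1
    refine sum_congr rfl fun h _ => ?_
    rw [← wt_step (S ∪ D) a haS h, mul_sum]
    refine sum_congr rfl fun v _ => ?_
    rw [hφ (Function.update h a v) h]
    intro i hi
    rw [Function.update_of_ne]; rintro rfl; exact hD.1 hi

/-- Functions of degree at most `d`: the span of the functions depending on at most `d` values. -/
def Jd (N d : ℕ) : Submodule ℝ ((Fin N → Fin N) → ℝ) :=
  Submodule.span ℝ {φ | ∃ S : Finset (Fin N), S.card ≤ d ∧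
    ∀ h h' : Fin N → Fin N, (∀ i ∈ S, h i = h' i) → φ h = φ h'}

open Polynomial in
theorem wt_Jd {N d : ℕ} (hN : 1 ≤ N) (q : (Fin N → Fin N) → ℝ) (hq : q ∈ Jd N d) :
    (∑ h, C (q h) * wt univ h).natDegree ≤ d := by
  unfold Jd at hq
  induction hq using Submodule.span_induction with
  | mem φ hφ =>
    obtain ⟨S, hS, hφ⟩ := hφ
    have := wt_marginal φ S hφ Sᶜ disjoint_compl_right
    rw [union_compl] at this
    have h2 : (∑ h, C (φ h) * wt S h).natDegree ≤ d := by
      refine natDegree_sum_le_of_forall_le _ _ fun h _ => ?_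
      exact (natDegree_C_mul_le _ _).trans ((wt_natDegree S h).trans hS)
    rw [← this] at h2
    have e : (N:ℝ[X]) ^ (#Sᶜ) = C ((N:ℝ) ^ (#Sᶜ)) := by simp
    rw [e, natDegree_C_mul (by positivity)] at h2
    exact h2
  | zero => simp
  | add f g _ _ hf hg =>
    simp only [Pi.add_apply, C_add, add_mul, sum_add_distrib]
    exact natDegree_add_le_of_degree_le hf hg
  | smul a f _ hf =>
    simp only [Pi.smul_apply, smul_eq_mul, C_mul, mul_assoc]
    rw [← mul_sum]
    exact (natDegree_C_mul_le _ _).trans hf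

open Polynomial in
theorem wt_total {N : ℕ} (hN : 1 ≤ N) : ∑ h : Fin N → Fin N, wt univ h = 1 := by
  have := wt_marginal (N := N) (fun _ => 1) ∅ (fun _ _ _ => rfl) univ (disjoint_empty_left _)
  simp only [card_univ, Fintype.card_fin, C_1, one_mul, empty_union] at this
  have e : ∑ h : Fin N → Fin N, wt ∅ h = (N:ℝ[X])^N * 1 := by
    simp [wt]
  rw [e] at this
  exact mul_left_cancel₀ (pow_ne_zero _ (by exact_mod_cast (by omega : N ≠ 0))) this

open Polynomial in
theorem wt_nonneg {N : ℕ} (h : Fin N → Fin N) (M : ℕ) (hM : 1 ≤ M) : 0 ≤ (wt univ h).eval (1 / (M:ℝ)) := by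
  unfold wt
  have hMp : (0:ℝ) < M := by exact_mod_cast hM
  simp only [eval_mul, eval_C, eval_pow, eval_X, eval_prod, eval_sub, eval_one]
  apply mul_nonneg (by positivity)
  set k := #(univ.image h)
  rcases Nat.lt_or_ge M k with hlt | hge
  · rw [prod_eq_zero (mem_range.2 hlt)]
    field_simp; simp
  · refine prod_nonneg fun i hi => ?_
    rw [mem_range] at hi
    have : (i:ℝ) ≤ M := by exact_mod_cast (by omega : i ≤ M)
    rw [mul_one_div, sub_nonneg, div_le_one hMp]; exact this

open Polynomial in
theorem wt_inj {N : ℕ} (h : Fin N → Fin N) (hh : Function.Injective h) :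
    wt univ h = C (1 / (N.factorial : ℝ)) * ∏ i ∈ range N, (1 - C (i:ℝ) * X) := by
  unfold wt
  rw [card_image_of_injective _ hh]
  simp [Nat.descFactorial_self]

open Polynomial in
theorem wt_noninj {N : ℕ} (h : Fin N → Fin N) (hh : ¬ Function.Injective h) :
    (wt univ h).eval 0 = 0 := by
  unfold wt
  have : #(univ.image h) < N := by
    rcases Nat.lt_or_ge #(univ.image h) N with h1 | h1
    · exact h1
    · exfalso
      apply hh
      have h2 : #(univ.image h) = #(univ : Finset (Fin N)) := le_antisymm card_image_le (by simpa using h1)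
      simpa using card_image_iff.1 h2
  simp only [eval_mul, eval_pow, eval_X]
  rw [zero_pow (by simp; omega)]
  simp


theorem prod_small {N : ℕ} (hN : 2 ≤ N) :
    ∏ i ∈ range N, (1 - (i:ℝ) * (1 / ((N^2 : ℕ) : ℝ))) ≤ 4 / 5 := by
  have hNp : (2:ℝ) ≤ N := by exact_mod_cast hN
  have h1 : ∏ i ∈ range N, (1 - (i:ℝ) * (1 / ((N^2 : ℕ) : ℝ))) ≤
      ∏ i ∈ range N, Real.exp (-((i:ℝ) * (1 / ((N^2 : ℕ) : ℝ)))) := by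
    refine prod_le_prod (fun i hi => ?_) (fun i hi => ?_)
    · rw [mem_range] at hi
      have : (i:ℝ) ≤ N := by exact_mod_cast hi.le
      rw [mul_one_div, sub_nonneg, div_le_one (by positivity)]
      push_cast
      nlinarith
    · have := Real.add_one_le_exp (-((i:ℝ) * (1 / ((N^2 : ℕ) : ℝ))))
      linarith
  refine h1.trans ?_
  rw [← Real.exp_sum, sum_neg_distrib, ← sum_mul]
  have hs : ∑ i ∈ range N, (i:ℝ) = N * (N - 1) / 2 := by
    have := Finset.sum_range_id_mul_two N
    have h3 : ((∑ i ∈ range N, i : ℕ) : ℝ) * 2 = N * (N - 1) := by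
      have := congrArg (Nat.cast : ℕ → ℝ) this
      rw [Nat.cast_mul, Nat.cast_mul, Nat.cast_sub (by omega)] at this
      simpa using this
    push_cast at h3
    linarith
  rw [hs]
  have h2 : (1:ℝ)/4 ≤ N * (N - 1) / 2 * (1 / ((N^2 : ℕ) : ℝ)) := by
    push_cast
    rw [mul_one_div, le_div_iff₀ (by positivity)]
    nlinarith
  have h3 := Real.add_one_le_exp ((1:ℝ)/4)
  rw [Real.exp_neg]
  have h4 : (5:ℝ)/4 ≤ Real.exp (N * (N - 1) / 2 * (1 / ((N^2 : ℕ) : ℝ))) :=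
    le_trans (by linarith) (Real.exp_le_exp.2 h2)
  calc _ ≤ ((5:ℝ)/4)⁻¹ := by gcongr
    _ = 4/5 := by norm_num

open Classical in
/-- The unnormalised hard distribution, on non-injective functions. -/
def nu (N : ℕ) (h : Fin N → Fin N) : ℝ :=
  if Function.Injective h then 0 else (wt univ h).eval (1 / ((N^2 : ℕ) : ℝ))

open Polynomial Classical in
theorem key_bound {N d : ℕ} (hN : 2 ≤ N) (Q : ℝ) (hQ1 : 1 ≤ Q) (hQ : 4 * (harmonic d : ℝ) ≤ Q)
    (hsmall : 8 * Q * (d:ℝ)^3 / ((N^2 : ℕ) : ℝ) ≤ 1 / 15) :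
    (1 / 5 : ℝ) ≤ ∑ h, nu N h ∧
    ∀ q ∈ Jd N d, ∀ B : ℝ, (∀ h, Function.Injective h → q h ≤ 0) →
      (∀ h, ¬ Function.Injective h → 0 ≤ q h ∧ q h ≤ B) → 0 ≤ B →
      ∑ h, nu N h * q h ≤ B / 15 := by
  set y : ℝ := 1 / ((N^2 : ℕ) : ℝ) with hy
  set I : Finset (Fin N → Fin N) := univ.filter (fun h => Function.Injective h) with hI
  set π : ℝ → ℝ := fun x => ∏ i ∈ range N, (1 - (i:ℝ) * x) with hπ
  have hN1 : 1 ≤ N := by omega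
  have hNN : 1 ≤ N^2 := Nat.one_le_pow _ _ (by omega)
  have hwI : ∀ h ∈ I, ∀ x : ℝ, (wt univ h).eval x = 1 / (N.factorial : ℝ) * π x := by
    intro h hh x
    rw [wt_inj h (mem_filter.1 hh).2]
    simp [eval_prod, hπ]
  have hwc : ∀ h ∈ Iᶜ, ¬ Function.Injective h := by
    intro h hh; simpa [hI] using hh
  have hπ0 : π 0 = 1 := by simp [hπ]
  have htot : ∀ x : ℝ, ∑ h ∈ I, (wt univ h).eval x + ∑ h ∈ Iᶜ, (wt univ h).eval x = 1 := by
    intro x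
    rw [sum_add_sum_compl, ← eval_finsetSum, wt_total hN1, eval_one]
  have hcnt : (#I : ℝ) * (1 / (N.factorial : ℝ)) = 1 := by
    have h0 := htot 0
    rw [sum_eq_zero (s := Iᶜ) (fun h hh => wt_noninj h (hwc h hh)), add_zero,
      sum_congr rfl (fun h hh => hwI h hh 0), hπ0, sum_const] at h0
    simpa using h0
  have hmassI : ∀ x : ℝ, ∑ h ∈ I, (wt univ h).eval x = π x := by
    intro x
    rw [sum_congr rfl (fun h hh => hwI h hh x), sum_const, nsmul_eq_mul, ← mul_assoc, hcnt, one_mul]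
  have hmassC : ∀ x : ℝ, ∑ h ∈ Iᶜ, (wt univ h).eval x = 1 - π x := by
    intro x
    have := htot x
    rw [hmassI] at this
    linarith
  have hπy : π y ≤ 4 / 5 := prod_small hN
  have hnu : ∀ q : (Fin N → Fin N) → ℝ, ∑ h, nu N h * q h = ∑ h ∈ Iᶜ, (wt univ h).eval y * q h := by
    intro q
    rw [← sum_add_sum_compl I, sum_eq_zero (s := I), zero_add]
    · refine sum_congr rfl fun h hh => ?_
      rw [nu, if_neg (hwc h hh)]
    · intro h hh
      rw [nu, if_pos (mem_filter.1 hh).2, zero_mul]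
  refine ⟨?_, ?_⟩
  · have := hnu (fun _ => 1)
    simp only [mul_one] at this
    rw [this, hmassC]
    linarith
  intro q hq B hqI hqC hB
  rw [hnu]
  set v : ℝ := -(∑ h ∈ I, 1 / (N.factorial : ℝ) * q h) with hv
  have hv0 : 0 ≤ v := by
    rw [hv, neg_nonneg]
    refine sum_nonpos fun h hh => ?_
    exact mul_nonpos_of_nonneg_of_nonpos (by positivity) (hqI h (mem_filter.1 hh).2)
  set P : ℝ[X] := (∑ h, C (q h) * wt univ h) + C v with hP
  have hPdeg : P.natDegree ≤ d := natDegree_add_le_of_degree_le (wt_Jd hN1 q hq) (by simp)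
  have hPx : ∀ x : ℝ, P.eval x = v * (1 - π x) + ∑ h ∈ Iᶜ, (wt univ h).eval x * q h := by
    intro x
    rw [hP, eval_add, eval_C, eval_finsetSum, ← sum_add_sum_compl I]
    simp only [eval_mul, eval_C]
    have : ∑ h ∈ I, q h * (wt univ h).eval x = - v * π x := by
      rw [hv, neg_neg, sum_mul]
      refine sum_congr rfl fun h hh => ?_
      rw [hwI h hh]; ring
    rw [this, sum_congr rfl (fun h _ => mul_comm (q h) _)]
    ring
  have hP0 : P.eval 0 = 0 := by
    rw [hPx, hπ0, sum_eq_zero]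
    · ring
    · intro h hh
      rw [wt_noninj h (hwc h hh), zero_mul]
  have hPM : ∀ M : ℕ, 1 ≤ M → |P.eval (1 / (M:ℝ))| ≤ v + B := by
    intro M hM
    set x : ℝ := 1 / (M:ℝ)
    have hw : ∀ h : Fin N → Fin N, 0 ≤ (wt univ h).eval x := fun h => wt_nonneg h M hM
    have h1 : 0 ≤ π x := by rw [← hmassI]; exact sum_nonneg fun h _ => hw h
    have h2 : 0 ≤ 1 - π x := by rw [← hmassC]; exact sum_nonneg fun h _ => hw h
    have h3 : 0 ≤ ∑ h ∈ Iᶜ, (wt univ h).eval x * q h :=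
      sum_nonneg fun h hh => mul_nonneg (hw h) (hqC h (hwc h hh)).1
    have h4 : ∑ h ∈ Iᶜ, (wt univ h).eval x * q h ≤ (1 - π x) * B := by
      rw [← hmassC, sum_mul]
      exact sum_le_sum fun h hh => mul_le_mul_of_nonneg_left (hqC h (hwc h hh)).2 (hw h)
    rw [hPx, abs_of_nonneg (by positivity)]
    nlinarith
  have hd0 : (0:ℝ) ≤ Q * (d:ℝ)^3 := by positivity
  have hNp : (0:ℝ) < ((N^2 : ℕ) : ℝ) := by exact_mod_cast hNN
  have hM0 : Q * (d:ℝ)^3 ≤ ((N^2 : ℕ) : ℝ) := by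
    rw [div_le_iff₀ hNp] at hsmall
    nlinarith
  have hmain := node_bound P hPdeg hP0 (v + B) hPM Q hQ1 hQ (N^2) hM0 hNN
  have h5 := (le_abs_self _).trans (hmain.trans (mul_le_mul_of_nonneg_right hsmall (by positivity : 0 ≤ v + B)))
  rw [← hy, hPx] at h5
  nlinarith

/-- Amplification over the `t` blocks. -/
theorem tensor {N d : ℕ} (μ : (Fin N → Fin N) → ℝ) (hμ0 : ∀ h, 0 ≤ μ h) (hμ1 : ∑ h, μ h = 1)
    (hμI : ∀ h, Function.Injective h → μ h = 0)
    (hkey : ∀ q ∈ Jd N d, ∀ B : ℝ, (∀ h, Function.Injective h → q h ≤ 0) →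
      (∀ h, ¬ Function.Injective h → 0 ≤ q h ∧ q h ≤ B) → 0 ≤ B → ∑ h, μ h * q h ≤ B / 3)
    {t : ℕ} (p : (Fin t → Fin N → Fin N) → ℝ) (B : ℝ)
    (hpJ : ∀ z a, (fun u => p (Function.update z a u)) ∈ Jd N d)
    (hp1 : ∀ z, (∀ i, ¬ Function.Injective (z i)) → 1 ≤ p z ∧ p z ≤ B)
    (hp2 : ∀ z, (∃ i, Function.Injective (z i)) → p z ≤ 0) :
    (3:ℝ)^t ≤ B := by
  have main : ∀ A : Finset (Fin t), ∃ r : (Fin t → Fin N → Fin N) → ℝ,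
      (∀ z, ∀ a ∉ A, (fun u => r (Function.update z a u)) ∈ Jd N d) ∧
      (∀ z, (∀ i, ¬ Function.Injective (z i)) → 1 ≤ r z ∧ r z ≤ B / 3 ^ A.card) ∧
      (∀ z, (∃ i ∉ A, Function.Injective (z i)) → r z ≤ 0) := by
    intro A
    induction A using Finset.induction_on with
    | empty =>
      refine ⟨p, fun z a _ => hpJ z a, ?_, ?_⟩
      · simpa using hp1
      · simpa using hp2
    | insert a A ha ih =>
      obtain ⟨r, h1, h2, h3⟩ := ih
      refine ⟨fun z => ∑ u, μ u * r (Function.update z a u), ?_, ?_, ?_⟩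
      · intro z b hb
        rw [mem_insert, not_or] at hb
        have e : (fun u => ∑ v, μ v * r (Function.update (Function.update z b u) a v)) =
            ∑ v, μ v • (fun u => r (Function.update (Function.update z a v) b u)) := by
          funext u
          simp only [Finset.sum_apply, Pi.smul_apply, smul_eq_mul]
          refine sum_congr rfl fun v _ => ?_
          rw [Function.update_comm hb.1]
        rw [e]
        exact Submodule.sum_mem _ fun v _ => Submodule.smul_mem _ _ (h1 _ b hb.2)
      · intro z hz
        have hupd : ∀ u, ¬ Function.Injective u → ∀ i, ¬ Function.Injective (Function.update z a u i) := by
          intro u hu i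
          by_cases hi : i = a
          · subst hi; simpa using hu
          · rw [Function.update_of_ne hi]; exact hz i
        constructor
        · rw [← hμ1]
          refine sum_le_sum fun u _ => ?_
          by_cases hu : Function.Injective u
          · rw [hμI u hu]; simp
          · have := (h2 _ (hupd u hu)).1
            nlinarith [hμ0 u]
        · have hBA : 0 ≤ B / 3 ^ #A := by
            have := h2 z hz; linarith
          have := hkey (fun u => r (Function.update z a u)) (h1 z a ha) (B / 3 ^ #A) ?_ ?_ hBA
          · refine this.trans (le_of_eq ?_)
            rw [card_insert_of_notMem ha, pow_succ, div_div]
          · intro u hu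
            exact h3 _ ⟨a, ha, by simpa using hu⟩
          · intro u hu
            have := h2 _ (hupd u hu)
            exact ⟨by linarith, this.2⟩
      · rintro z ⟨i, hi, hz⟩
        rw [mem_insert, not_or] at hi
        refine sum_nonpos fun u _ => mul_nonpos_of_nonneg_of_nonpos (hμ0 u) (h3 _ ⟨i, hi.2, ?_⟩)
        rw [Function.update_of_ne hi.1]; exact hz
  obtain ⟨r, -, h2, -⟩ := main univ
  obtain ⟨h, hh⟩ : ∃ h : Fin N → Fin N, ¬ Function.Injective h := by
    by_contra hcon
    push Not at hcon
    rw [sum_eq_zero (fun h _ => hμI h (hcon h))] at hμ1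
    norm_num at hμ1
  have := h2 (fun _ => h) (fun _ => hh)
  rw [card_univ, Fintype.card_fin] at this
  have h4 := this.1.trans this.2
  rw [le_div_iff₀ (by positivity)] at h4
  linarith


/-- The bit string encoding a function. -/
def bitsOf {k : ℕ} (h : Fin (2 ^ k) → Fin (2 ^ k)) : Fin (2 ^ k) × Fin k → Bool :=
  fun e => decide (finFunctionFinEquiv.symm (h e.1) e.2 = 1)

theorem gOf_bitsOf {k : ℕ} (h : Fin (2 ^ k) → Fin (2 ^ k)) : gOf (bitsOf h) = h := by
  funext i
  unfold gOf bitsOf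
  rw [← Equiv.eq_symm_apply]
  funext j
  simp only [decide_eq_true_eq]
  generalize finFunctionFinEquiv.symm (h i) j = b
  revert b
  decide

/-- The bit string encoding a tuple of functions. -/
def allBits {k t : ℕ} (z : Fin t → Fin (2 ^ k) → Fin (2 ^ k)) : Fin t × (Fin (2 ^ k) × Fin k) → Bool :=
  fun e => bitsOf (z e.1) e.2

theorem or_allBits {k t : ℕ} (z : Fin t → Fin (2 ^ k) → Fin (2 ^ k)) :
    orBlock t (ED k) (allBits z) = true ↔ ∃ i, Function.Injective (z i) := by
  unfold orBlock
  rw [decide_eq_true_eq]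
  refine exists_congr fun i => ?_
  unfold ED
  rw [decide_eq_true_eq]
  have : gOf (fun j => allBits z (i, j)) = z i := gOf_bitsOf (z i)
  rw [this]

theorem poly_mem {k t d : ℕ} (q : Finset (Fin t × (Fin (2 ^ k) × Fin k)) → ℤ)
    (hq : ∀ S, d < S.card → q S = 0) (z : Fin t → Fin (2 ^ k) → Fin (2 ^ k)) (a : Fin t) :
    (fun u => polyOf (fun S => (q S : ℝ)) (allBits (Function.update z a u))) ∈ Jd (2 ^ k) d := by
  have e : (fun u => polyOf (fun S => (q S : ℝ)) (allBits (Function.update z a u))) =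
      ∑ S, (q S : ℝ) • (fun u => chi S (allBits (Function.update z a u))) := by
    funext u
    simp only [polyOf, Finset.sum_apply, Pi.smul_apply, smul_eq_mul]
  rw [e]
  refine Submodule.sum_mem _ fun S _ => ?_
  by_cases hS : d < S.card
  · rw [hq S hS]; simp
  refine Submodule.smul_mem _ _ (Submodule.subset_span ⟨S.image (fun e => e.2.1), card_image_le.trans (by omega), ?_⟩)
  intro h h' hh
  unfold chi
  refine prod_congr rfl fun e he => ?_
  congr 1
  unfold allBits
  by_cases hea : e.1 = a
  · rw [hea, Function.update_self, Function.update_self]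
    unfold bitsOf
    rw [hh e.2.1 (mem_image_of_mem _ he)]
  · rw [Function.update_of_ne hea, Function.update_of_ne hea]

theorem abs_chi {ι : Type*} (S : Finset ι) (x : ι → Bool) : |chi S x| = 1 := by
  unfold chi
  rw [abs_prod]
  refine prod_eq_one fun i _ => ?_
  unfold bval
  split_ifs <;> simp

theorem poly_le {ι : Type*} [Fintype ι] (q : Finset ι → ℤ) (x : ι → Bool) :
    polyOf (fun S => (q S : ℝ)) x ≤ ((∑ S, |q S| : ℤ) : ℝ) := by
  unfold polyOf
  push_cast
  refine sum_le_sum fun S _ => ?_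
  refine (le_abs_self _).trans ?_
  rw [abs_mul, abs_chi, mul_one]

theorem poly_int {ι : Type*} [Fintype ι] (q : Finset ι → ℤ) (x : ι → Bool) :
    ∃ n : ℤ, polyOf (fun S => (q S : ℝ)) x = n := by
  refine ⟨∑ S, q S * ∏ i ∈ S, (if x i then -1 else 1), ?_⟩
  unfold polyOf chi bval
  push_cast
  rfl

theorem budget {k d : ℕ} (hk : 1 ≤ k)
    (hd : (d : ℝ) < 1 / 16 * ((2 ^ k : ℕ) : ℝ) ^ ((2 : ℝ) / 3) / (k : ℝ)) :
    4 * (harmonic d : ℝ) ≤ 8 * k ∧ 8 * (8 * (k:ℝ)) * (d:ℝ)^3 / (((2 ^ k)^2 : ℕ) : ℝ) ≤ 1 / 15 := by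
  have hk1 : (1:ℝ) ≤ k := by exact_mod_cast hk
  set N : ℝ := ((2 ^ k : ℕ) : ℝ) with hN
  have hN1 : 1 ≤ N := by
    rw [hN]; exact_mod_cast Nat.one_le_two_pow
  have hcube : (d:ℝ)^3 ≤ N^2 / (4096 * (k:ℝ)^3) := by
    calc (d:ℝ)^3 ≤ (1 / 16 * N ^ ((2 : ℝ) / 3) / (k : ℝ))^3 := by gcongr
      _ = (N ^ ((2 : ℝ) / 3))^3 / (4096 * (k:ℝ)^3) := by ring
      _ = N^2 / (4096 * (k:ℝ)^3) := by
        rw [← Real.rpow_natCast (N ^ ((2 : ℝ) / 3)) 3, ← Real.rpow_mul (by positivity)]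
        norm_num
  constructor
  · have hdN : (d:ℝ) ≤ N := by
      by_contra hcon
      push Not at hcon
      have h1 : N^3 < (d:ℝ)^3 := by gcongr
      have h2 : N^2 / (4096 * (k:ℝ)^3) ≤ N^2 := by
        apply div_le_self (by positivity)
        have : (1:ℝ) ≤ (k:ℝ)^3 := one_le_pow₀ hk1
        linarith
      nlinarith [sq_nonneg N]
    have hlog : Real.log d ≤ k := by
      rcases Nat.eq_zero_or_pos d with rfl | hd0
      · simp
      · have h1 : Real.log d ≤ Real.log N := Real.log_le_log (by exact_mod_cast hd0) hdN
        have h2 : Real.log N = k * Real.log 2 := by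
          rw [hN]; push_cast; rw [Real.log_pow]
        have h3 : Real.log 2 ≤ 1 := by linarith [Real.log_two_lt_d9]
        nlinarith
    have := harmonic_le_one_add_log d
    linarith
  · have e : (((2 ^ k)^2 : ℕ) : ℝ) = N^2 := by rw [hN]; push_cast; ring
    rw [e, div_le_iff₀ (by positivity)]
    calc 8 * (8 * (k:ℝ)) * (d:ℝ)^3 ≤ 8 * (8 * (k:ℝ)) * (N^2 / (4096 * (k:ℝ)^3)) := by gcongr
      _ = N^2 / (64 * (k:ℝ)^2) := by field_simp; norm_num
      _ ≤ N^2 / 15 := by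
        gcongr
        nlinarith
      _ = 1 / 15 * N^2 := by ring

/-- for some constant `c > 0`, for all `N = 2^k ≥ 2`, `t ≥ 1`, and every
degree `d < c · N^{2/3} / log₂ N`, every degree-`d` polynomial threshold function (integer
coefficients, sign-representing) for `OR_t(ED_N, …, ED_N)` has weight greater than `2^t`. -/
theorem or_ed_threshold_weight :
    ∃ c : ℝ, 0 < c ∧ ∀ k t d : ℕ, 1 ≤ k → 1 ≤ t →
      (d : ℝ) < c * ((2 ^ k : ℕ) : ℝ) ^ ((2 : ℝ) / 3) / (k : ℝ) →
      ∀ q : Finset (Fin t × (Fin (2 ^ k) × Fin k)) → ℤ,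
        (∀ S, d < S.card → q S = 0) →
        (∀ x, 0 < bval (orBlock t (ED k) x) * polyOf (fun S => (q S : ℝ)) x) →
        (2 : ℤ) ^ t < ∑ S : Finset (Fin t × (Fin (2 ^ k) × Fin k)), |q S| := by
  refine ⟨1 / 16, by norm_num, ?_⟩
  intro k t d hk ht hd q hq hsign
  by_contra hcon
  push Not at hcon
  obtain ⟨hb1, hb2⟩ := budget hk hd
  have hk1 : (1:ℝ) ≤ k := by exact_mod_cast hk
  have hN : 2 ≤ 2 ^ k := by
    calc 2 = 2 ^ 1 := rfl
      _ ≤ 2 ^ k := Nat.pow_le_pow_right (by norm_num) hk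
  obtain ⟨hmass, hkey⟩ := key_bound hN (8 * k) (by linarith) hb1 hb2
  set m : ℝ := ∑ h, nu (2 ^ k) h with hm
  have hm0 : 0 < m := by linarith
  have hnu0 : ∀ h, 0 ≤ nu (2 ^ k) h := by
    intro h
    unfold nu
    split_ifs
    · exact le_rfl
    · exact wt_nonneg h _ (Nat.one_le_pow _ _ (by omega))
  have hfin := tensor (d := d) (fun h => nu (2 ^ k) h / m) (fun h => div_nonneg (hnu0 h) hm0.le)
    (by rw [← sum_div]; exact div_self hm0.ne') (fun h hh => by simp [nu, hh])
    (by
      intro r hr B h1 h2 hB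
      have := hkey r hr B h1 h2 hB
      simp only [div_mul_eq_mul_div]
      rw [← sum_div, div_le_iff₀ hm0]
      nlinarith)
    (t := t) (fun z => polyOf (fun S => (q S : ℝ)) (allBits z)) (2 ^ t)
    (fun z a => poly_mem q hq z a)
    (by
      intro z hz
      have hor : orBlock t (ED k) (allBits z) = false := by
        rw [← Bool.not_eq_true, or_allBits]
        push Not
        exact hz
      have hs := hsign (allBits z)
      rw [hor] at hs
      simp only [bval, Bool.false_eq_true, if_false, one_mul] at hs
      constructor
      · obtain ⟨n, hn⟩ := poly_int q (allBits z)
        simp only [hn] at hs ⊢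
        have : 0 < n := by exact_mod_cast hs
        exact_mod_cast this
      · refine (poly_le q _).trans ?_
        exact_mod_cast hcon)
    (by
      intro z hz
      have hs := hsign (allBits z)
      rw [(or_allBits z).2 hz] at hs
      simp only [bval, if_true] at hs
      linarith)
  have hlt : (2:ℝ)^t < 3^t := pow_lt_pow_left₀ (by norm_num) (by norm_num) (by omega)
  linarith

end
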